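/- Let n ≥ 1, let Ω ⊂ ℝ^n be open, and let f ∈ L^1_loc(Ω). If liminf_{ε→0} κ_ε(f, Ω) < ∞, then Var(f, Ω) < ∞, and moreover (1/4)·Var(f, Ω) ≤ liminf_{ε→0} κ_ε(f, Ω). -/

import Mathlib

open MeasureTheory Filter Topology Metric
open scoped ENNReal RealInnerProductSpace Classical

noncomputable section

/-- An open cube in `ℝⁿ` with side length `ε` and arbitrary orientation. -/
def IsCube (n : ℕ) (ε : ℝ) (Q : Set (EuclideanSpace ℝ (Fin n))) : Prop :=
  ∃ (T : EuclideanSpace ℝ (Fin n) ≃ₗᵢ[ℝ] EuclideanSpace ℝ (Fin n))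
    (x : EuclideanSpace ℝ (Fin n)),
    Q = (fun y => x + T y) '' {y : EuclideanSpace ℝ (Fin n) | ∀ i, |y i| < ε / 2}

/-- The BMO-type functional `κ_ε(f, Ω)`. -/
def kappa (n : ℕ) (ε : ℝ) (f : EuclideanSpace ℝ (Fin n) → ℝ)
    (Ω : Set (EuclideanSpace ℝ (Fin n))) : ℝ≥0∞ :=
  ENNReal.ofReal (ε ^ (n - 1)) *
    ⨆ (F : Set (Set (EuclideanSpace ℝ (Fin n))))
      (_ : ∀ Q ∈ F, IsCube n ε Q ∧ Q ⊆ Ω) (_ : F.Pairwise Disjoint),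
      ∑' Q : F, ENNReal.ofReal
        (⨍ x in (Q : Set (EuclideanSpace ℝ (Fin n))),
          |f x - ⨍ y in (Q : Set (EuclideanSpace ℝ (Fin n))), f y ∂volume| ∂volume)

/-- The divergence of a vector field on `ℝⁿ`. -/
def vdiv (n : ℕ) (Φ : EuclideanSpace ℝ (Fin n) → EuclideanSpace ℝ (Fin n))
    (x : EuclideanSpace ℝ (Fin n)) : ℝ :=
  ∑ i : Fin n, fderiv ℝ Φ x (EuclideanSpace.single i 1) i

/-- The variation `Var(f, Ω)`. -/
def variation (n : ℕ) (f : EuclideanSpace ℝ (Fin n) → ℝ)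
    (Ω : Set (EuclideanSpace ℝ (Fin n))) : ℝ≥0∞ :=
  ⨆ (Φ : EuclideanSpace ℝ (Fin n) → EuclideanSpace ℝ (Fin n))
    (_ : ContDiff ℝ 1 Φ) (_ : HasCompactSupport Φ) (_ : tsupport Φ ⊆ Ω)
    (_ : ∀ x, ‖Φ x‖ ≤ 1),
    ENNReal.ofReal (∫ x in Ω, f x * vdiv n Φ x)

/-- The approximate jump set `J_f`. -/
def jumpSet (n : ℕ) (f : EuclideanSpace ℝ (Fin n) → ℝ) : Set (EuclideanSpace ℝ (Fin n)) :=
  {x | ∃ ν : EuclideanSpace ℝ (Fin n), ‖ν‖ = 1 ∧ ∃ a b : ℝ, a ≠ b ∧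
    Tendsto (fun r : ℝ =>
        ⨍ y in {y ∈ ball x r | 0 < ⟪y - x, ν⟫}, |f y - a| ∂volume)
      (𝓝[>] 0) (𝓝 0) ∧
    Tendsto (fun r : ℝ =>
        ⨍ y in {y ∈ ball x r | ⟪y - x, ν⟫ < 0}, |f y - b| ∂volume)
      (𝓝[>] 0) (𝓝 0)}

/-- The approximate discontinuity set `S_f` (the set of non-Lebesgue points). -/
def approxDiscontSet (n : ℕ) (f : EuclideanSpace ℝ (Fin n) → ℝ) :
    Set (EuclideanSpace ℝ (Fin n)) :=
  {x | ¬ ∃ c : ℝ,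
    Tendsto (fun r : ℝ => ⨍ y in ball x r, |f y - c| ∂volume) (𝓝[>] 0) (𝓝 0)}

/-- `(μ, σ)` is the polar decomposition `Df = σ |Df|` of the gradient measure of `f` on `Ω`:
`μ` plays the role of the total variation measure `|Df|` and `σ` of the polar vector field. -/
def IsVariationPair (n : ℕ) (f : EuclideanSpace ℝ (Fin n) → ℝ)
    (Ω : Set (EuclideanSpace ℝ (Fin n))) (μ : Measure (EuclideanSpace ℝ (Fin n)))
    (σ : EuclideanSpace ℝ (Fin n) → EuclideanSpace ℝ (Fin n)) : Prop :=
  IsFiniteMeasure μ ∧ μ Ωᶜ = 0 ∧ AEStronglyMeasurable σ μ ∧ (∀ᵐ x ∂μ, ‖σ x‖ = 1) ∧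
  ∀ Φ : EuclideanSpace ℝ (Fin n) → EuclideanSpace ℝ (Fin n),
    ContDiff ℝ 1 Φ → HasCompactSupport Φ → tsupport Φ ⊆ Ω →
    ∫ x in Ω, f x * vdiv n Φ x = - ∫ x, ⟪Φ x, σ x⟫ ∂μ

/-- `|D^a f|(Ω)`, the total variation of the absolutely continuous part of `Df`,
with the convention that it is `∞` if `f` is not of bounded variation in `Ω`. -/
def absVar (n : ℕ) (f : EuclideanSpace ℝ (Fin n) → ℝ)
    (Ω : Set (EuclideanSpace ℝ (Fin n))) : ℝ≥0∞ :=
  if h : ∃ p : Measure (EuclideanSpace ℝ (Fin n)) ×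
      (EuclideanSpace ℝ (Fin n) → EuclideanSpace ℝ (Fin n)),
      IsVariationPair n f Ω p.1 p.2 then
    volume.withDensity ((h.choose.1).rnDeriv volume) Ω
  else ⊤

/-- `|D^c f|(Ω)`, the total variation of the Cantor part of `Df`,
with the convention that it is `∞` if `f` is not of bounded variation in `Ω`. -/
def cantorVar (n : ℕ) (f : EuclideanSpace ℝ (Fin n) → ℝ)
    (Ω : Set (EuclideanSpace ℝ (Fin n))) : ℝ≥0∞ :=
  if h : ∃ p : Measure (EuclideanSpace ℝ (Fin n)) ×
      (EuclideanSpace ℝ (Fin n) → EuclideanSpace ℝ (Fin n)),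
      IsVariationPair n f Ω p.1 p.2 then
    (h.choose.1.singularPart volume) (Ω \ approxDiscontSet n f)
  else ⊤

/-- `|D^j f|(Ω)`, the total variation of the jump part of `Df`,
with the convention that it is `∞` if `f` is not of bounded variation in `Ω`. -/
def jumpVar (n : ℕ) (f : EuclideanSpace ℝ (Fin n) → ℝ)
    (Ω : Set (EuclideanSpace ℝ (Fin n))) : ℝ≥0∞ :=
  if h : ∃ p : Measure (EuclideanSpace ℝ (Fin n)) ×
      (EuclideanSpace ℝ (Fin n) → EuclideanSpace ℝ (Fin n)),
      IsVariationPair n f Ω p.1 p.2 then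
    (h.choose.1.singularPart volume) (jumpSet n f ∩ Ω)
  else ⊤

/-- `g` is the weak (distributional) gradient of `u` on `Ω`. -/
def HasWeakGradientOn (n : ℕ) (u : EuclideanSpace ℝ (Fin n) → ℝ)
    (g : EuclideanSpace ℝ (Fin n) → EuclideanSpace ℝ (Fin n))
    (Ω : Set (EuclideanSpace ℝ (Fin n))) : Prop :=
  ∀ φ : EuclideanSpace ℝ (Fin n) → ℝ,
    ContDiff ℝ 1 φ → HasCompactSupport φ → tsupport φ ⊆ Ω →
    ∀ k : Fin n,
      ∫ x in Ω, u x * fderiv ℝ φ x (EuclideanSpace.single k 1) =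
        - ∫ x in Ω, φ x * g x k

/-- `f ∈ BV(Ω)`: `f` is integrable on `Ω` and has finite variation in `Ω`. -/
def IsBVOn (n : ℕ) (f : EuclideanSpace ℝ (Fin n) → ℝ)
    (Ω : Set (EuclideanSpace ℝ (Fin n))) : Prop :=
  IntegrableOn f Ω volume ∧ variation n f Ω < ⊤

/-- `f ∈ SBV(Ω)`: `f ∈ BV(Ω)` and the Cantor part of `Df` vanishes. -/
def IsSBVOn (n : ℕ) (f : EuclideanSpace ℝ (Fin n) → ℝ)
    (Ω : Set (EuclideanSpace ℝ (Fin n))) : Prop :=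
  IsBVOn n f Ω ∧ cantorVar n f Ω = 0

/-- The open cube of side length `ε` centred at the origin, with axis-parallel sides. -/
def centeredCube (n : ℕ) (ε : ℝ) : Set (EuclideanSpace ℝ (Fin n)) :=
  {y | ∀ i, |y i| < ε / 2}

/-- The closed cube of side length `ε` centred at the origin, with axis-parallel sides. -/
def closedCenteredCube (n : ℕ) (ε : ℝ) : Set (EuclideanSpace ℝ (Fin n)) :=
  {y | ∀ i, |y i| ≤ ε / 2}

/-- The sign of the `i`-th coordinate, restricted to `centeredCube n ε`. -/
def cubeSign {n : ℕ} (i : Fin n) (ε : ℝ) : EuclideanSpace ℝ (Fin n) → ℝ :=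
  (centeredCube n ε).indicator fun y => Real.sign (y i)

section Cube

variable {n : ℕ} {ε : ℝ}

theorem isOpen_centeredCube : IsOpen (centeredCube n ε) := by
  simp only [centeredCube, Set.ofPred_forall]
  exact isOpen_iInter_of_finite fun i => isOpen_lt (by fun_prop) continuous_const

theorem isClosed_closedCenteredCube : IsClosed (closedCenteredCube n ε) := by
  simp only [closedCenteredCube, Set.ofPred_forall]
  exact isClosed_iInter fun i => isClosed_le (by fun_prop) continuous_const

theorem centeredCube_subset_closedCenteredCube :
    centeredCube n ε ⊆ closedCenteredCube n ε :=
  fun _ hy i => (hy i).le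

theorem volume_centeredCube : volume (centeredCube n ε) = ENNReal.ofReal ε ^ n := by
  have h := (PiLp.volume_preserving_toLp (Fin n)).measure_preimage
    (s := centeredCube n ε) isOpen_centeredCube.measurableSet.nullMeasurableSet
  rw [← h]
  have : WithLp.toLp 2 ⁻¹' centeredCube n ε =
      Set.pi Set.univ fun _ : Fin n => Set.Ioo (-(ε / 2)) (ε / 2) := by
    ext y
    simp [centeredCube, abs_lt]
  rw [this, Real.volume_pi_Ioo]
  simp

theorem volume_closedCenteredCube : volume (closedCenteredCube n ε) = ENNReal.ofReal ε ^ n := by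
  have h := (PiLp.volume_preserving_toLp (Fin n)).measure_preimage
    (s := closedCenteredCube n ε) isClosed_closedCenteredCube.measurableSet.nullMeasurableSet
  rw [← h]
  have : WithLp.toLp 2 ⁻¹' closedCenteredCube n ε =
      Set.pi Set.univ fun _ : Fin n => Set.Icc (-(ε / 2)) (ε / 2) := by
    ext y
    simp [closedCenteredCube, abs_le, Pi.le_def, forall_and]
  rw [this, volume_pi, Measure.pi_pi]
  simp

theorem integral_abs_Ioo (hε : 0 ≤ ε) : ∫ t in Set.Ioo (-(ε / 2)) (ε / 2), |t| = ε ^ 2 / 4 := by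
  rw [← integral_Ioc_eq_integral_Ioo, ← intervalIntegral.integral_of_le (by linarith),
    ← intervalIntegral.integral_add_adjacent_intervals (b := 0)
      (continuous_abs.intervalIntegrable _ _) (continuous_abs.intervalIntegrable _ _)]
  have h1 : ∫ t in (-(ε / 2))..0, |t| = ∫ t in (-(ε / 2))..0, -t :=
    intervalIntegral.integral_congr fun t ht => by
      rw [Set.uIcc_of_le (by linarith)] at ht
      exact abs_of_nonpos ht.2
  have h2 : ∫ t in (0:ℝ)..(ε / 2), |t| = ∫ t in (0:ℝ)..(ε / 2), t :=
    intervalIntegral.integral_congr fun t ht => by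
      rw [Set.uIcc_of_le (by linarith)] at ht
      exact abs_of_nonneg ht.1
  rw [h1, h2, intervalIntegral.integral_neg, integral_id, integral_id]
  ring

theorem integral_abs_centeredCube (i : Fin n) (hε : 0 ≤ ε) :
    ∫ y in centeredCube n ε, |y i| = ε ^ (n + 1) / 4 := by
  let F : Fin n → ℝ → ℝ := fun j =>
    (Set.Ioo (-(ε / 2)) (ε / 2)).indicator fun t => if j = i then |t| else 1
  have hF : ∀ x : Fin n → ℝ, (centeredCube n ε).indicator (fun y => |y i|) (WithLp.toLp 2 x)
      = ∏ j, F j (x j) := by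
    intro x
    by_cases hx : WithLp.toLp 2 x ∈ centeredCube n ε
    · rw [Set.indicator_of_mem hx]
      have : ∀ j, F j (x j) = if j = i then |x j| else 1 := fun j =>
        Set.indicator_of_mem (Set.mem_Ioo.2 (abs_lt.1 (hx j))) _
      simp [this]
    · rw [Set.indicator_of_notMem hx]
      simp only [centeredCube, Set.mem_ofPred_eq, not_forall] at hx
      obtain ⟨j, hj⟩ := hx
      refine (Finset.prod_eq_zero (Finset.mem_univ j) ?_).symm
      exact Set.indicator_of_notMem (fun h => hj (abs_lt.2 (Set.mem_Ioo.1 h))) _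
  rw [← integral_indicator isOpen_centeredCube.measurableSet,
    ← (PiLp.volume_preserving_toLp (Fin n)).integral_comp
      (MeasurableEquiv.toLp 2 (Fin n → ℝ)).measurableEmbedding]
  simp_rw [hF]
  rw [integral_fintype_prod_volume_eq_prod, ← Finset.mul_prod_erase _ _ (Finset.mem_univ i)]
  have h1 : ∫ t, F i t = ε ^ 2 / 4 := by
    simp only [F, if_true]
    rw [integral_indicator measurableSet_Ioo, integral_abs_Ioo hε]
  have h2 : ∀ j ∈ Finset.univ.erase i, ∫ t, F j t = ε := by
    intro j hj
    simp only [F, if_neg (Finset.ne_of_mem_erase hj)]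
    rw [integral_indicator measurableSet_Ioo]
    simp [hε]
  rw [h1, Finset.prod_congr rfl h2, Finset.prod_const, Finset.card_erase_of_mem (Finset.mem_univ i),
    Finset.card_univ, Fintype.card_fin]
  obtain ⟨m, rfl⟩ : ∃ m, n = m + 1 := ⟨n - 1, by have := i.pos; omega⟩
  simp
  ring

theorem norm_le_of_mem_closedCenteredCube (hε : 0 ≤ ε) {y : EuclideanSpace ℝ (Fin n)}
    (hy : y ∈ closedCenteredCube n ε) : ‖y‖ ≤ n * ε := by
  rw [EuclideanSpace.norm_eq]
  refine Real.sqrt_le_iff.2 ⟨by positivity, ?_⟩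
  calc ∑ i, ‖y i‖ ^ 2 ≤ ∑ _i : Fin n, ε ^ 2 := by
        refine Finset.sum_le_sum fun i _ => pow_le_pow_left₀ (norm_nonneg _) ?_ 2
        exact (hy i).trans (by linarith)
    _ = n * ε ^ 2 := by simp
    _ ≤ (n * ε) ^ 2 := by
        rw [mul_pow]
        refine mul_le_mul_of_nonneg_right ?_ (sq_nonneg ε)
        exact_mod_cast Nat.le_self_pow two_ne_zero n

theorem measurable_cubeSign (i : Fin n) : Measurable (cubeSign i ε) := by
  refine Measurable.indicator ?_ isOpen_centeredCube.measurableSet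
  have : Measurable Real.sign := by
    unfold Real.sign
    exact Measurable.ite measurableSet_Iio measurable_const
      (Measurable.ite measurableSet_Ioi measurable_const measurable_const)
  fun_prop

theorem abs_cubeSign_le (i : Fin n) (y : EuclideanSpace ℝ (Fin n)) :
    |cubeSign i ε y| ≤ (centeredCube n ε).indicator 1 y := by
  by_cases hy : y ∈ centeredCube n ε
  · rcases Real.sign_apply_eq (y i) with h | h | h <;> simp [cubeSign, hy, h]
  · simp [cubeSign, hy]

theorem abs_cubeSign_le_one (i : Fin n) (y : EuclideanSpace ℝ (Fin n)) :
    |cubeSign i ε y| ≤ 1 :=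
  (abs_cubeSign_le i y).trans (Set.indicator_le_self' (by simp) y)

theorem integrable_cubeSign_mul (i : Fin n) {h : EuclideanSpace ℝ (Fin n) → ℝ}
    (hh : IntegrableOn h (centeredCube n ε)) : Integrable fun y => cubeSign i ε y * h y := by
  have : (fun y => cubeSign i ε y * h y) =
      fun y => cubeSign i ε y * (centeredCube n ε).indicator h y := by
    ext y
    by_cases hy : y ∈ centeredCube n ε <;> simp [cubeSign, hy]
  rw [this]
  exact ((integrable_indicator_iff isOpen_centeredCube.measurableSet).2 hh).bdd_mul
    (measurable_cubeSign i).aestronglyMeasurable (ae_of_all _ (abs_cubeSign_le_one i))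

/-- The reflection of `ℝⁿ` that changes the sign of the `i`-th coordinate. -/
def coordReflection (i : Fin n) : EuclideanSpace ℝ (Fin n) ≃ₗᵢ[ℝ] EuclideanSpace ℝ (Fin n) :=
  LinearIsometryEquiv.piLpCongrRight 2 fun j =>
    if j = i then LinearIsometryEquiv.neg ℝ else LinearIsometryEquiv.refl ℝ ℝ

theorem coordReflection_apply (i j : Fin n) (y : EuclideanSpace ℝ (Fin n)) :
    coordReflection i y j = if j = i then - y j else y j := by
  unfold coordReflection
  simp only [LinearIsometryEquiv.piLpCongrRight_apply]
  split_ifs <;> simp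

theorem sub_coordReflection (i : Fin n) (y : EuclideanSpace ℝ (Fin n)) :
    y - coordReflection i y = (2 * y i) • EuclideanSpace.single i (1 : ℝ) := by
  ext j
  by_cases h : j = i
  · subst h
    simp [coordReflection_apply]
    ring
  · simp [coordReflection_apply, h]

theorem coordReflection_mem_centeredCube_iff (i : Fin n) {y : EuclideanSpace ℝ (Fin n)} :
    coordReflection i y ∈ centeredCube n ε ↔ y ∈ centeredCube n ε := by
  refine forall_congr' fun j => ?_
  rw [coordReflection_apply]
  split_ifs <;> simp

theorem cubeSign_coordReflection (i : Fin n) (y : EuclideanSpace ℝ (Fin n)) :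
    cubeSign i ε (coordReflection i y) = - cubeSign i ε y := by
  by_cases hy : y ∈ centeredCube n ε
  · have hy' := (coordReflection_mem_centeredCube_iff i).2 hy
    simp [cubeSign, hy, hy', coordReflection_apply, Real.sign_neg]
  · have hy' : coordReflection i y ∉ centeredCube n ε :=
      fun h => hy ((coordReflection_mem_centeredCube_iff i).1 h)
    simp [cubeSign, hy, hy']

theorem integral_cubeSign_mul_comp_coordReflection (i : Fin n)
    (h : EuclideanSpace ℝ (Fin n) → ℝ) :
    ∫ y, cubeSign i ε y * h (coordReflection i y) = - ∫ y, cubeSign i ε y * h y := by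
  rw [← (coordReflection i).measurePreserving.integral_comp
    (coordReflection i).toHomeomorph.measurableEmbedding (fun y => cubeSign i ε y * h y),
    ← integral_neg]
  simp [cubeSign_coordReflection]

theorem integral_cubeSign (i : Fin n) : ∫ y, cubeSign i ε y = 0 := by
  have := integral_cubeSign_mul_comp_coordReflection (ε := ε) i fun _ => 1
  simp only [mul_one] at this
  linarith

end Cube

/-- The open cube of side length `ε` with centre `c` and orientation `T`. -/
def orientedCube {n : ℕ} (T : EuclideanSpace ℝ (Fin n) ≃ₗᵢ[ℝ] EuclideanSpace ℝ (Fin n))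
    (c : EuclideanSpace ℝ (Fin n)) (ε : ℝ) : Set (EuclideanSpace ℝ (Fin n)) :=
  (fun y => c + T y) '' centeredCube n ε

section OrientedCube

variable {n : ℕ} {ε : ℝ} {T : EuclideanSpace ℝ (Fin n) ≃ₗᵢ[ℝ] EuclideanSpace ℝ (Fin n)}
  {c : EuclideanSpace ℝ (Fin n)}

theorem measurePreserving_add_linearIsometryEquiv
    (T : EuclideanSpace ℝ (Fin n) ≃ₗᵢ[ℝ] EuclideanSpace ℝ (Fin n)) (c : EuclideanSpace ℝ (Fin n)) :
    MeasurePreserving fun y => c + T y :=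
  (measurePreserving_add_left volume c).comp T.measurePreserving

theorem measurableEmbedding_add_linearIsometryEquiv
    (T : EuclideanSpace ℝ (Fin n) ≃ₗᵢ[ℝ] EuclideanSpace ℝ (Fin n)) (c : EuclideanSpace ℝ (Fin n)) :
    MeasurableEmbedding fun y => c + T y :=
  (T.toHomeomorph.trans (Homeomorph.addLeft c)).measurableEmbedding

theorem mem_orientedCube {x : EuclideanSpace ℝ (Fin n)} :
    x ∈ orientedCube T c ε ↔ T.symm (x - c) ∈ centeredCube n ε := by
  constructor
  · rintro ⟨y, hy, rfl⟩
    simpa using hy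
  · intro h
    exact ⟨_, h, by simp⟩

theorem isOpen_orientedCube : IsOpen (orientedCube T c ε) :=
  (T.toHomeomorph.trans (Homeomorph.addLeft c)).isOpenMap _ isOpen_centeredCube

theorem self_mem_orientedCube (hε : 0 < ε) : c ∈ orientedCube T c ε := by
  rw [mem_orientedCube]
  intro i
  simpa using hε

theorem volume_orientedCube : volume (orientedCube T c ε) = ENNReal.ofReal ε ^ n := by
  rw [← volume_centeredCube, orientedCube,
    ← (measurePreserving_add_linearIsometryEquiv T c).measure_preimage_emb
      (measurableEmbedding_add_linearIsometryEquiv T c),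
    (measurableEmbedding_add_linearIsometryEquiv T c).injective.preimage_image]

theorem orientedCube_subset_closedBall (hε : 0 ≤ ε) :
    orientedCube T c ε ⊆ closedBall c (n * ε) := by
  rintro _ ⟨y, hy, rfl⟩
  simpa [dist_eq_norm] using
    norm_le_of_mem_closedCenteredCube hε (centeredCube_subset_closedCenteredCube hy)

theorem setIntegral_orientedCube (h : EuclideanSpace ℝ (Fin n) → ℝ) :
    ∫ x in orientedCube T c ε, h x = ∫ y in centeredCube n ε, h (c + T y) :=
  (measurePreserving_add_linearIsometryEquiv T c).setIntegral_image_emb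
    (measurableEmbedding_add_linearIsometryEquiv T c) h _

theorem integrableOn_orientedCube_iff {h : EuclideanSpace ℝ (Fin n) → ℝ} :
    IntegrableOn h (orientedCube T c ε) ↔
      IntegrableOn (fun y => h (c + T y)) (centeredCube n ε) :=
  (measurePreserving_add_linearIsometryEquiv T c).integrableOn_image
    (measurableEmbedding_add_linearIsometryEquiv T c)

theorem integral_cubeSign_mul_comp (i : Fin n) (h : EuclideanSpace ℝ (Fin n) → ℝ) :
    ∫ y, cubeSign i ε y * h (c + T y) = ∫ x, h x * cubeSign i ε (T.symm (x - c)) := by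
  rw [← (measurePreserving_add_linearIsometryEquiv T c).integral_comp
    (measurableEmbedding_add_linearIsometryEquiv T c)
    fun x => h x * cubeSign i ε (T.symm (x - c))]
  simp [mul_comm]

theorem integral_cubeSign_mul_le_average (i : Fin n) (hε : 0 < ε)
    {h : EuclideanSpace ℝ (Fin n) → ℝ} (hh : IntegrableOn h (orientedCube T c ε)) :
    ∫ y, cubeSign i ε y * h (c + T y) ≤
      ε ^ n * ⨍ x in orientedCube T c ε, |h x - ⨍ y in orientedCube T c ε, h y| := by
  set a := ⨍ y in orientedCube T c ε, h y
  have hfin : volume (centeredCube n ε) ≠ ⊤ := by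
    rw [volume_centeredCube]
    exact ENNReal.pow_ne_top ENNReal.ofReal_ne_top
  have hh' := integrableOn_orientedCube_iff.1 hh
  have hc : IntegrableOn (fun _ => a) (centeredCube n ε) := integrableOn_const hfin
  have hd : IntegrableOn (fun y => h (c + T y) - a) (centeredCube n ε) := hh'.sub hc
  have h1 : ∫ y, cubeSign i ε y * h (c + T y) = ∫ y, cubeSign i ε y * (h (c + T y) - a) := by
    simp_rw [mul_sub]
    rw [integral_sub (integrable_cubeSign_mul i hh') (integrable_cubeSign_mul i hc),
      integral_mul_const, integral_cubeSign, zero_mul, sub_zero]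
  have h2 : ∫ y, cubeSign i ε y * (h (c + T y) - a) ≤
      ∫ y in centeredCube n ε, |h (c + T y) - a| := by
    rw [← integral_indicator isOpen_centeredCube.measurableSet]
    refine integral_mono (integrable_cubeSign_mul i hd)
      ((integrable_indicator_iff isOpen_centeredCube.measurableSet).2 hd.abs) fun y => ?_
    refine (le_abs_self _).trans ?_
    dsimp only
    rw [abs_mul]
    by_cases hy : y ∈ centeredCube n ε
    · rw [Set.indicator_of_mem hy]
      exact mul_le_of_le_one_left (abs_nonneg _) (abs_cubeSign_le_one i y)
    · rw [Set.indicator_of_notMem hy]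
      simp [cubeSign, hy]
  have hv : volume.real (orientedCube T c ε) = ε ^ n := by
    rw [measureReal_def, volume_orientedCube, ENNReal.toReal_pow, ENNReal.toReal_ofReal hε.le]
  rw [h1, setAverage_eq, hv, smul_eq_mul, setIntegral_orientedCube fun x => |h x - a|,
    mul_inv_cancel_left₀ (by positivity)]
  exact h2

theorem le_integral_cubeSign_mul (i : Fin n) (hε : 0 ≤ ε) {g : EuclideanSpace ℝ (Fin n) → ℝ}
    (hg : ContDiff ℝ 1 g) {D : ℝ}
    (hD : ∀ x ∈ closedBall c (n * ε), D ≤ fderiv ℝ g x (T (EuclideanSpace.single i 1))) :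
    ε ^ (n + 1) / 4 * D ≤ ∫ y, cubeSign i ε y * g (c + T y) := by
  set G : EuclideanSpace ℝ (Fin n) → ℝ := fun y => g (c + T y) with hG
  have hGc : Continuous G := hg.continuous.comp (by fun_prop)
  have hsub : centeredCube n ε ⊆ closedBall 0 (n * ε) := fun y hy => by
    simpa using norm_le_of_mem_closedCenteredCube hε (centeredCube_subset_closedCenteredCube hy)
  have hInt : ∀ {u : EuclideanSpace ℝ (Fin n) → ℝ}, Continuous u →
      IntegrableOn u (centeredCube n ε) := fun hu =>
    (hu.continuousOn.integrableOn_compact (isCompact_closedBall 0 (n * ε))).mono_set hsub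
  have hGi := integrable_cubeSign_mul i (hInt hGc)
  have hGi' := integrable_cubeSign_mul i (hInt (hGc.comp (coordReflection i).continuous))
  simp only [Function.comp_apply] at hGi'
  have h2 : 2 * ∫ y, cubeSign i ε y * G y =
      ∫ y, cubeSign i ε y * (G y - G (coordReflection i y)) := by
    simp_rw [mul_sub]
    rw [integral_sub hGi hGi', integral_cubeSign_mul_comp_coordReflection]
    ring
  have h3 : ∫ y in centeredCube n ε, 2 * D * |y i| ≤
      ∫ y, cubeSign i ε y * (G y - G (coordReflection i y)) := by
    rw [← integral_indicator isOpen_centeredCube.measurableSet]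
    refine integral_mono ((integrable_indicator_iff isOpen_centeredCube.measurableSet).2
      (hInt (by fun_prop))) (integrable_cubeSign_mul i
      (hInt (hGc.sub (hGc.comp (coordReflection i).continuous)))) fun y => ?_
    dsimp only
    by_cases hy : y ∈ centeredCube n ε
    swap
    · simp [cubeSign, hy]
    have hmem : ∀ w ∈ centeredCube n ε, c + T w ∈ closedBall c (n * ε) := fun w hw => by
      simpa using hsub hw
    obtain ⟨z, hz, hmv⟩ := domain_mvt (f := g) (f' := fun x => fderiv ℝ g x)
      (x := c + T (coordReflection i y)) (y := c + T y)
      (fun x _ => ((hg.differentiable one_ne_zero) x).hasFDerivAt.hasFDerivWithinAt)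
      (convex_closedBall c (n * ε)) (hmem _ ((coordReflection_mem_centeredCube_iff i).2 hy))
      (hmem _ hy)
    have hz' := hD z ((convex_closedBall c (n * ε)).segment_subset
      (hmem _ ((coordReflection_mem_centeredCube_iff i).2 hy)) (hmem _ hy) hz)
    rw [add_sub_add_left_eq_sub, ← map_sub, sub_coordReflection, map_smul, map_smul,
      smul_eq_mul] at hmv
    rw [Set.indicator_of_mem hy, hG]
    dsimp only
    rw [hmv, cubeSign, Set.indicator_of_mem hy]
    have hs : Real.sign (y i) * y i = |y i| := by
      rcases lt_trichotomy (y i) 0 with h | h | h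
      · rw [Real.sign_of_neg h, abs_of_neg h]; ring
      · simp [h]
      · rw [Real.sign_of_pos h, abs_of_pos h]; ring
    calc 2 * D * |y i| = 2 * |y i| * D := by ring
      _ ≤ 2 * |y i| * fderiv ℝ g z (T (EuclideanSpace.single i 1)) := by gcongr
      _ = _ := by rw [← hs]; ring
  rw [integral_const_mul, integral_abs_centeredCube i hε] at h3
  linarith

end OrientedCube

section Mollification

variable {n : ℕ}

open scoped Convolution

theorem integral_convolution_mul_le {ρ f S : EuclideanSpace ℝ (Fin n) → ℝ}
    (hρ : Integrable ρ) (hρ0 : ∀ t, 0 ≤ ρ t) (hρ1 : ∫ t, ρ t = 1) (hf : Integrable f)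
    (hS : Measurable S) {C : ℝ} (hC : ∀ x, |S x| ≤ C) {M : ℝ}
    (hM : ∀ t ∈ Function.support ρ, ∫ x, f x * S (x + t) ≤ M) :
    ∫ x, (ρ ⋆[ContinuousLinearMap.lsmul ℝ ℝ, volume] f) x * S x ≤ M := by
  have hInt : Integrable (Function.uncurry fun x t => S x * (ρ t * f (x - t)))
      (volume.prod volume) :=
    (hρ.convolution_integrand (ContinuousLinearMap.lsmul ℝ ℝ) hf).bdd_mul
      (hS.comp measurable_fst).aestronglyMeasurable (ae_of_all _ fun p => hC p.1)
  have h1 : ∫ x, (ρ ⋆[ContinuousLinearMap.lsmul ℝ ℝ, volume] f) x * S x =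
      ∫ t, ∫ x, S x * (ρ t * f (x - t)) := by
    rw [← integral_integral_swap hInt]
    refine integral_congr_ae (ae_of_all _ fun x => ?_)
    simp only [convolution_def, ContinuousLinearMap.lsmul_apply, smul_eq_mul]
    rw [integral_const_mul, mul_comm]
  have h2 : ∀ t, ∫ x, S x * (ρ t * f (x - t)) = ρ t * ∫ x, f x * S (x + t) := by
    intro t
    rw [← integral_add_right_eq_self _ t, ← integral_const_mul]
    refine integral_congr_ae (ae_of_all _ fun x => ?_)
    simp only [add_sub_cancel_right]
    ring
  have h3 := hInt.integral_prod_right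
  simp only [Function.uncurry_apply_pair, h2] at h3
  rw [h1]
  simp_rw [h2]
  calc ∫ t, ρ t * ∫ x, f x * S (x + t) ≤ ∫ t, ρ t * M := by
        refine integral_mono h3 (hρ.mul_const M) fun t => ?_
        by_cases ht : ρ t = 0
        · simp [ht]
        · exact mul_le_mul_of_nonneg_left (hM t ht) (hρ0 t)
    _ = M := by rw [integral_mul_const, hρ1, one_mul]

end Mollification

section Covering

variable {n : ℕ}

theorem IsCompact.exists_disjoint_compact_refinement {X : Type*} [TopologicalSpace X] [T2Space X]
    [MeasurableSpace X] [BorelSpace X] {μ : Measure X} [μ.InnerRegularCompactLTTop]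
    [IsFiniteMeasureOnCompacts μ] {K : Set X} (hK : IsCompact K) {U : X → Set X}
    (hUo : ∀ x, IsOpen (U x)) (hU : ∀ x, x ∈ U x) {δ : ℝ≥0∞} (hδ : δ ≠ 0) :
    ∃ (m : ℕ) (a : Fin m → X) (C : Fin m → Set X), (∀ j, IsCompact (C j)) ∧
      (∀ j, C j ⊆ K ∩ U (a j)) ∧ Pairwise (Function.onFun Disjoint C) ∧
      μ (K \ ⋃ j, C j) ≤ δ := by
  obtain ⟨t, -, ht⟩ := hK.elim_nhds_subcover U fun x _ => (hUo x).mem_nhds (hU x)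
  set m := t.card
  let a : Fin m → X := fun j => t.equivFin.symm j
  let B : Fin m → Set X := disjointed fun j => U (a j)
  have hBm : ∀ j, MeasurableSet (K ∩ B j) := fun j =>
    hK.measurableSet.inter <|
    disjointedRec (fun _ _ h => h.diff (hUo _).measurableSet) (hUo (a j)).measurableSet
  have hδ' : δ / m ≠ 0 := ENNReal.div_ne_zero.2 ⟨hδ, ENNReal.natCast_ne_top m⟩
  choose C hCB hCc hCμ using fun j => (hBm j).exists_isCompact_sdiff_lt
    ((measure_mono Set.inter_subset_left).trans_lt hK.measure_lt_top).ne (μ := μ) hδ'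
  refine ⟨m, a, C, hCc, fun j => (hCB j).trans
    (Set.inter_subset_inter_right _ (disjointed_subset _ j)), fun j l hjl => ?_, ?_⟩
  · exact (disjoint_disjointed (fun j => U (a j)) hjl).mono
      ((hCB j).trans Set.inter_subset_right) ((hCB l).trans Set.inter_subset_right)
  · have hsub : K \ ⋃ j, C j ⊆ ⋃ j, (K ∩ B j) \ C j := by
      rintro x ⟨hxK, hxC⟩
      obtain ⟨y, hy, hxy⟩ := Set.mem_iUnion₂.1 (ht hxK)
      have : x ∈ ⋃ j, U (a j) :=
        Set.mem_iUnion.2 ⟨t.equivFin ⟨y, hy⟩, by simpa [a] using hxy⟩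
      rw [← iUnion_disjointed] at this
      obtain ⟨j, hj⟩ := Set.mem_iUnion.1 this
      exact Set.mem_iUnion.2 ⟨j, ⟨hxK, hj⟩, fun h => hxC (Set.mem_iUnion.2 ⟨j, h⟩)⟩
    calc μ (K \ ⋃ j, C j) ≤ ∑ j, μ ((K ∩ B j) \ C j) :=
          (measure_mono hsub).trans (measure_iUnion_fintype_le _ _)
      _ ≤ ∑ _j : Fin m, δ / m := Finset.sum_le_sum fun j _ => (hCμ j).le
      _ = m * (δ / m) := by simp
      _ ≤ δ := ENNReal.mul_div_le

theorem exists_linearIsometryEquiv_apply_eq_norm {E : Type*} [NormedAddCommGroup E]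
    [InnerProductSpace ℝ E] [CompleteSpace E] (L : E →L[ℝ] ℝ) {e : E} (he : ‖e‖ = 1) :
    ∃ T : E ≃ₗᵢ[ℝ] E, L (T e) = ‖L‖ := by
  by_cases hL : L = 0
  · exact ⟨LinearIsometryEquiv.refl ℝ E, by simp [hL]⟩
  set v := (InnerProductSpace.toDual ℝ E).symm L with hv
  have hvn : ‖v‖ = ‖L‖ := LinearIsometryEquiv.norm_map _ _
  have hL0 : ‖L‖ ≠ 0 := norm_ne_zero_iff.2 hL
  have hw : ‖e‖ = ‖‖v‖⁻¹ • v‖ := by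
    rw [he, norm_smul, norm_inv, norm_norm, hvn, inv_mul_cancel₀ hL0]
  refine ⟨(ℝ ∙ (e - ‖v‖⁻¹ • v))ᗮ.reflection, ?_⟩
  rw [Submodule.reflection_sub hw, map_smul, ← InnerProductSpace.toDual_symm_apply (y := L), ← hv,
    real_inner_self_eq_norm_sq, hvn, smul_eq_mul]
  field_simp

theorem eventually_exists_cube_packing {ι : Type*} [Fintype ι]
    {K : ι → Set (EuclideanSpace ℝ (Fin n))} (hK : ∀ j, IsCompact (K j))
    (hd : Pairwise (Function.onFun Disjoint K))
    (T : ι → EuclideanSpace ℝ (Fin n) ≃ₗᵢ[ℝ] EuclideanSpace ℝ (Fin n)) :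
    ∀ᶠ ε in 𝓝[>] (0 : ℝ), ∃ (P : Finset (ι × (Fin n → ℤ)))
      (c : ι × (Fin n → ℤ) → EuclideanSpace ℝ (Fin n)),
      (∀ p ∈ P, ∃ x ∈ K p.1, (T p.1).symm (x - c p) ∈ closedCenteredCube n ε) ∧
      (P : Set (ι × (Fin n → ℤ))).PairwiseDisjoint (fun p => orientedCube (T p.1) (c p) ε) ∧
      ∀ j, ∀ x ∈ K j, ∃ p ∈ P, p.1 = j ∧ (T j).symm (x - c p) ∈ closedCenteredCube n ε := by
  have hsep : ∀ j l, ∀ᶠ ε in 𝓝[>] (0 : ℝ), j ≠ l →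
      Disjoint (cthickening (2 * (n * ε)) (K j)) (cthickening (2 * (n * ε)) (K l)) := by
    intro j l
    by_cases hjl : j = l
    · exact Eventually.of_forall fun _ h => absurd hjl h
    obtain ⟨δ, hδ, hdis⟩ := (hd hjl).exists_cthickenings (hK j) (hK l).isClosed
    have hlim : Tendsto (fun ε : ℝ => 2 * (n * ε)) (𝓝[>] 0) (𝓝 0) := by
      have : Continuous fun ε : ℝ => 2 * (n * ε) := by fun_prop
      simpa using (this.tendsto 0).mono_left nhdsWithin_le_nhds
    filter_upwards [hlim.eventually (eventually_le_nhds hδ)] with ε hε _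
    exact hdis.mono (cthickening_mono hε _) (cthickening_mono hε _)
  filter_upwards [eventually_all.2 fun j => eventually_all.2 (hsep j), self_mem_nhdsWithin]
    with ε hsepε hε
  have hε : 0 < ε := hε
  let c : ι × (Fin n → ℤ) → EuclideanSpace ℝ (Fin n) := fun p =>
    T p.1 (WithLp.toLp 2 fun i => ε * (p.2 i : ℝ))
  have hcoord : ∀ p x i, (T p.1).symm (x - c p) i = (T p.1).symm x i - ε * p.2 i := by
    intro p x i
    simp [c]
  have hfin : {p : ι × (Fin n → ℤ) | ∃ x ∈ K p.1,
      (T p.1).symm (x - c p) ∈ closedCenteredCube n ε}.Finite := by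
    obtain ⟨R, hR⟩ := (isCompact_iUnion hK).isBounded.exists_norm_le
    obtain ⟨N, hN⟩ := exists_nat_ge ((R + ε / 2) / ε)
    refine (Set.finite_univ.prod (Set.finite_Icc (fun _ : Fin n => -(N : ℤ)) fun _ => N)).subset ?_
    rintro p ⟨x, hx, hxc⟩
    refine Set.mem_prod.2 ⟨Set.mem_univ _, ?_⟩
    have key : ∀ i, |p.2 i| ≤ (N : ℤ) := by
      intro i
      have h1 := hxc i
      rw [hcoord] at h1
      have h2 : |(T p.1).symm x i| ≤ R := by
        refine (PiLp.norm_apply_le ((T p.1).symm x) i).trans ?_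
        rw [LinearIsometryEquiv.norm_map]
        exact hR x (Set.mem_iUnion.2 ⟨p.1, hx⟩)
      have h3 : ε * |(p.2 i : ℝ)| ≤ R + ε / 2 := by
        rw [← abs_of_pos hε, ← abs_mul, abs_of_pos hε]
        rw [abs_le] at h1 h2 ⊢
        constructor <;> linarith
      rw [div_le_iff₀ hε] at hN
      have h4 : |(p.2 i : ℝ)| ≤ N := by
        refine le_of_mul_le_mul_left ?_ hε
        linarith
      exact_mod_cast h4
    exact ⟨fun i => (abs_le.1 (key i)).1, fun i => (abs_le.1 (key i)).2⟩
  have hmem : ∀ p ∈ hfin.toFinset, orientedCube (T p.1) (c p) ε ⊆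
      cthickening (2 * (n * ε)) (K p.1) := by
    intro p hp y hy
    obtain ⟨x, hx, hxc⟩ := hfin.mem_toFinset.1 hp
    refine mem_cthickening_of_dist_le y x _ _ hx ?_
    have h1 := orientedCube_subset_closedBall hε.le hy
    have h2 := norm_le_of_mem_closedCenteredCube hε.le hxc
    rw [LinearIsometryEquiv.norm_map, ← dist_eq_norm, dist_comm] at h2
    rw [mem_closedBall] at h1
    linarith [dist_triangle y (c p) x]
  refine ⟨hfin.toFinset, c, fun p hp => hfin.mem_toFinset.1 hp, fun p hp q hq hpq => ?_,
    fun j x hx => ?_⟩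
  · by_cases h : p.1 = q.1
    · refine Set.disjoint_left.2 fun y hyp hyq => hpq (Prod.ext h (funext fun i => ?_))
      have h1 := mem_orientedCube.1 hyp i
      have h2 := mem_orientedCube.1 hyq i
      rw [hcoord] at h1 h2
      rw [← h] at h2
      have h3 : ε * |(p.2 i : ℝ) - q.2 i| < ε * 1 := by
        rw [← abs_of_pos hε, ← abs_mul, abs_of_pos hε]
        rw [abs_lt] at h1 h2 ⊢
        constructor <;> linarith
      have h4 := lt_of_mul_lt_mul_left h3 hε.le
      have h5 : |p.2 i - q.2 i| < 1 := by exact_mod_cast h4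
      exact sub_eq_zero.1 (Int.abs_lt_one_iff.1 h5)
    · exact (hsepε p.1 q.1 h).mono (hmem p hp) (hmem q hq)
  · let p : ι × (Fin n → ℤ) := (j, fun i => round ((T j).symm x i / ε))
    have hp : (T j).symm (x - c p) ∈ closedCenteredCube n ε := by
      intro i
      have h := hcoord p x i
      dsimp only [p] at h
      rw [h]
      have h1 := abs_sub_round ((T j).symm x i / ε)
      calc |(T j).symm x i - ε * (round ((T j).symm x i / ε) : ℝ)|
          = |ε * ((T j).symm x i / ε - round ((T j).symm x i / ε))| := by
            rw [mul_sub, mul_div_cancel₀ _ hε.ne']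
        _ = ε * |(T j).symm x i / ε - round ((T j).symm x i / ε)| := by
            rw [abs_mul, abs_of_pos hε]
        _ ≤ ε / 2 := by linarith [mul_le_mul_of_nonneg_left h1 hε.le]
    exact ⟨p, hfin.mem_toFinset.2 ⟨x, hx, hp⟩, rfl, hp⟩

end Covering

section Kappa

variable {n : ℕ} {ε : ℝ} {f : EuclideanSpace ℝ (Fin n) → ℝ} {Ω : Set (EuclideanSpace ℝ (Fin n))}

theorem sum_average_le_kappa {ι : Type*} (hε : 0 < ε) (P : Finset ι)
    (T : ι → EuclideanSpace ℝ (Fin n) ≃ₗᵢ[ℝ] EuclideanSpace ℝ (Fin n))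
    (c : ι → EuclideanSpace ℝ (Fin n))
    (hd : (P : Set ι).PairwiseDisjoint fun p => orientedCube (T p) (c p) ε)
    (hΩ : ∀ p ∈ P, orientedCube (T p) (c p) ε ⊆ Ω) :
    ENNReal.ofReal (ε ^ (n - 1)) * ∑ p ∈ P, ENNReal.ofReal
      (⨍ x in orientedCube (T p) (c p) ε, |f x - ⨍ y in orientedCube (T p) (c p) ε, f y|) ≤
      kappa n ε f Ω := by
  refine mul_le_mul_right ?_ _
  set q : ι → Set (EuclideanSpace ℝ (Fin n)) := fun p => orientedCube (T p) (c p) ε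
  have hinj : Set.InjOn q P := fun p hp r hr hpr => by
    by_contra hne
    have := hd hp hr hne
    rw [Function.onFun, hpr] at this
    exact Set.disjoint_left.1 this (self_mem_orientedCube hε) (self_mem_orientedCube hε)
  refine le_iSup_of_le (q '' P) (le_iSup_of_le ?_ (le_iSup_of_le ?_ ?_))
  · rintro _ ⟨p, hp, rfl⟩
    exact ⟨⟨T p, c p, rfl⟩, hΩ p hp⟩
  · rintro _ ⟨p, hp, rfl⟩ _ ⟨r, hr, rfl⟩ hne
    exact hd hp hr fun h => hne (by rw [h])
  · rw [tsum_image (f := fun Q : Set (EuclideanSpace ℝ (Fin n)) => ENNReal.ofReal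
      (⨍ x in Q, |f x - ⨍ y in Q, f y|)) hinj]
    exact (Finset.tsum_subtype P fun p => ENNReal.ofReal
      (⨍ x in q p, |f x - ⨍ y in q p, f y|)).ge

theorem sum_integral_cubeSign_mul_le_kappa {ι : Type*} (i : Fin n) (hε : 0 < ε) (P : Finset ι)
    (T : ι → EuclideanSpace ℝ (Fin n) ≃ₗᵢ[ℝ] EuclideanSpace ℝ (Fin n))
    (c : ι → EuclideanSpace ℝ (Fin n))
    (hd : (P : Set ι).PairwiseDisjoint fun p => orientedCube (T p) (c p) ε)
    (hΩ : ∀ p ∈ P, orientedCube (T p) (c p) ε ⊆ Ω)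
    (hf : ∀ p ∈ P, IntegrableOn f (orientedCube (T p) (c p) ε)) (hfin : kappa n ε f Ω ≠ ⊤) :
    ∑ p ∈ P, ∫ y, cubeSign i ε y * f (c p + T p y) ≤ ε * (kappa n ε f Ω).toReal := by
  set A : ι → ℝ := fun p =>
    ⨍ x in orientedCube (T p) (c p) ε, |f x - ⨍ y in orientedCube (T p) (c p) ε, f y|
  have hA : ∀ p, 0 ≤ A p := fun p => by
    simp only [A]
    rw [setAverage_eq]
    exact smul_nonneg (by positivity) (integral_nonneg fun _ => abs_nonneg _)
  have h1 := ENNReal.toReal_mono hfin (sum_average_le_kappa (f := f) hε P T c hd hΩ)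
  rw [ENNReal.toReal_mul, ENNReal.toReal_ofReal (by positivity),
    ← ENNReal.ofReal_sum_of_nonneg fun p _ => hA p,
    ENNReal.toReal_ofReal (Finset.sum_nonneg fun p _ => hA p)] at h1
  calc ∑ p ∈ P, ∫ y, cubeSign i ε y * f (c p + T p y) ≤ ∑ p ∈ P, ε ^ n * A p :=
        Finset.sum_le_sum fun p hp => integral_cubeSign_mul_le_average i hε (hf p hp)
    _ = ε * (ε ^ (n - 1) * ∑ p ∈ P, A p) := by
        rw [← Finset.mul_sum, ← mul_assoc, ← pow_succ', Nat.sub_add_cancel i.pos]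
    _ ≤ _ := by gcongr

end Kappa

section Divergence

variable {n : ℕ} {Φ : EuclideanSpace ℝ (Fin n) → EuclideanSpace ℝ (Fin n)}

theorem vdiv_eq_zero_of_notMem_tsupport {x : EuclideanSpace ℝ (Fin n)} (hx : x ∉ tsupport Φ) :
    vdiv n Φ x = 0 := by
  simp [vdiv, fderiv_of_notMem_tsupport (𝕜 := ℝ) hx]

theorem continuous_vdiv (hΦ : ContDiff ℝ 1 Φ) : Continuous (vdiv n Φ) := by
  have := hΦ.continuous_fderiv one_ne_zero
  unfold vdiv
  fun_prop

theorem hasCompactSupport_vdiv (hΦc : HasCompactSupport Φ) : HasCompactSupport (vdiv n Φ) :=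
  HasCompactSupport.intro hΦc fun _ hx => vdiv_eq_zero_of_notMem_tsupport hx

theorem integral_mul_vdiv (hΦ : ContDiff ℝ 1 Φ) (hΦc : HasCompactSupport Φ)
    {g : EuclideanSpace ℝ (Fin n) → ℝ} (hg : ContDiff ℝ 1 g) :
    ∫ x, g x * vdiv n Φ x = - ∫ x, fderiv ℝ g x (Φ x) := by
  have hΦ' := hΦ.continuous_fderiv one_ne_zero
  have hg' := hg.continuous_fderiv one_ne_zero
  have hcoord : ∀ i, ContDiff ℝ 1 fun x => Φ x i := fun i => contDiff_euclidean.1 hΦ i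
  have hfd : ∀ x i, fderiv ℝ Φ x (EuclideanSpace.single i 1) i =
      fderiv ℝ (fun x => Φ x i) x (EuclideanSpace.single i 1) := by
    intro x i
    have := ((EuclideanSpace.proj i : EuclideanSpace ℝ (Fin n) →L[ℝ] ℝ).hasFDerivAt.comp x
      ((hΦ.differentiable one_ne_zero) x).hasFDerivAt).fderiv
    have h2 : (fun x => Φ x i) = (EuclideanSpace.proj i : EuclideanSpace ℝ (Fin n) →L[ℝ] ℝ) ∘ Φ :=
      rfl
    rw [h2, this]
    rfl
  have hci : ∀ i, HasCompactSupport fun x => Φ x i := fun i =>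
    hΦc.mono fun x hx h => hx (by simp [h])
  have hci' : ∀ i, HasCompactSupport fun x =>
      fderiv ℝ (fun x => Φ x i) x (EuclideanSpace.single i 1) := fun i => (hci i).fderiv_apply ℝ _
  have hcc : ∀ i, Continuous fun x => fderiv ℝ (fun x => Φ x i) x (EuclideanSpace.single i 1) :=
    fun i => by
      have := (hcoord i).continuous_fderiv one_ne_zero
      fun_prop
  have hgc := hg.continuous
  have hint1 : ∀ i, Integrable fun x =>
      g x * fderiv ℝ (fun x => Φ x i) x (EuclideanSpace.single i 1) := fun i =>
    (hgc.mul (hcc i)).integrable_of_hasCompactSupport (hci' i).mul_left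
  have hint2 : ∀ i, Integrable fun x => fderiv ℝ g x (EuclideanSpace.single i 1) * Φ x i :=
    fun i => Continuous.integrable_of_hasCompactSupport
      ((by fun_prop : Continuous fun x => fderiv ℝ g x (EuclideanSpace.single i 1)).mul
        (hcoord i).continuous) (hci i).mul_left
  have hint3 : ∀ i, Integrable fun x => g x * Φ x i := fun i =>
    (hgc.mul (hcoord i).continuous).integrable_of_hasCompactSupport (hci i).mul_left
  have hdec : ∀ x, fderiv ℝ g x (Φ x) =
      ∑ i, fderiv ℝ g x (EuclideanSpace.single i 1) * Φ x i := by
    intro x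
    conv_lhs => rw [← (EuclideanSpace.basisFun (Fin n) ℝ).sum_repr (Φ x)]
    simp [map_sum, mul_comm]
  simp_rw [hdec, vdiv, hfd, Finset.mul_sum]
  rw [integral_finsetSum _ fun i _ => hint1 i, integral_finsetSum _ fun i _ => hint2 i,
    ← Finset.sum_neg_distrib]
  refine Finset.sum_congr rfl fun i _ => ?_
  exact integral_mul_fderiv_eq_neg_fderiv_mul_of_integrable (hint2 i) (hint1 i) (hint3 i)
    (fun x _ => hg.differentiable one_ne_zero x) fun x _ => (hcoord i).differentiable one_ne_zero x

end Divergence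

section Estimate

variable {n : ℕ} {K : Set (EuclideanSpace ℝ (Fin n))}

/-- For a smooth function, the total variation on a compact set is almost attained by pairing with
coordinate signs on disjoint cubes whose orientation follows the gradient. -/
theorem eventually_setIntegral_norm_fderiv_le (i : Fin n) {g : EuclideanSpace ℝ (Fin n) → ℝ}
    (hg : ContDiff ℝ 1 g) (hgc : HasCompactSupport g) (hK : IsCompact K) {η r : ℝ} (hη : 0 < η)
    (hr : 0 < r) :
    ∀ᶠ ε in 𝓝[>] (0 : ℝ), ∃ (m : ℕ) (P : Finset (Fin m × (Fin n → ℤ)))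
      (T : Fin m × (Fin n → ℤ) → EuclideanSpace ℝ (Fin n) ≃ₗᵢ[ℝ] EuclideanSpace ℝ (Fin n))
      (c : Fin m × (Fin n → ℤ) → EuclideanSpace ℝ (Fin n)),
      (P : Set (Fin m × (Fin n → ℤ))).PairwiseDisjoint (fun p => orientedCube (T p) (c p) ε) ∧
      (∀ p ∈ P, orientedCube (T p) (c p) ε ⊆ cthickening r K) ∧
      ∫ x in K, ‖fderiv ℝ g x‖ ≤
        4 / ε * ∑ p ∈ P, (∫ y, cubeSign i ε y * g (c p + T p y)) +
          (1 + 3 * volume.real (cthickening r K)) * η := by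
  have hLc : Continuous (fderiv ℝ g) := hg.continuous_fderiv one_ne_zero
  obtain ⟨B, hB⟩ := (hgc.fderiv ℝ).exists_bound_of_continuous hLc
  have hB0 : 0 ≤ B := (norm_nonneg _).trans (hB 0)
  obtain ⟨δ, hδ, hLδ⟩ := Metric.uniformContinuous_iff.1
    ((hgc.fderiv ℝ).uniformContinuous_of_continuous hLc) η hη
  set e : EuclideanSpace ℝ (Fin n) := EuclideanSpace.single i 1
  have he : ‖e‖ = 1 := by simp [e]
  choose T hT using fun x => exists_linearIsometryEquiv_apply_eq_norm (fderiv ℝ g x) he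
  obtain ⟨m, a, C, hCc, hCU, hCd, hCμ⟩ := hK.exists_disjoint_compact_refinement (μ := volume)
    (U := fun x => {y | ‖fderiv ℝ g y‖ < fderiv ℝ g y (T x e) + η})
    (fun x => isOpen_lt (by fun_prop) (by fun_prop))
    (fun x => by simpa [hT] using hη)
    (δ := ENNReal.ofReal (η / (B + 1))) (by simpa using by positivity)
  have hlim : Tendsto (fun ε : ℝ => 2 * (n * ε)) (𝓝[>] 0) (𝓝 0) := by
    have : Continuous fun ε : ℝ => 2 * (n * ε) := by fun_prop
    simpa using (this.tendsto 0).mono_left nhdsWithin_le_nhds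
  filter_upwards [eventually_exists_cube_packing hCc hCd fun j => T (a j),
    hlim.eventually (eventually_lt_nhds hδ), hlim.eventually (eventually_lt_nhds hr),
    self_mem_nhdsWithin] with ε ⟨P, c, hPmeet, hPd, hPcov⟩ hεδ hεr hε
  have hε : 0 < ε := hε
  refine ⟨m, P, fun p => T (a p.1), c, hPd, ?_, ?_⟩
  · intro p hp y hy
    obtain ⟨x, hx, hxc⟩ := hPmeet p hp
    refine mem_cthickening_of_dist_le y x _ _ (hCU _ hx).1 ?_
    have h1 := orientedCube_subset_closedBall hε.le hy
    have h2 := norm_le_of_mem_closedCenteredCube hε.le hxc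
    rw [LinearIsometryEquiv.norm_map, ← dist_eq_norm, dist_comm] at h2
    rw [mem_closedBall] at h1
    linarith [dist_triangle y (c p) x]
  choose! x hxC hxc using hPmeet
  have hxb : ∀ p ∈ P, dist (x p) (c p) ≤ n * ε := fun p hp => by
    have := norm_le_of_mem_closedCenteredCube hε.le (hxc p hp)
    rwa [LinearIsometryEquiv.norm_map, ← dist_eq_norm] at this
  have hclose : ∀ p ∈ P, ∀ y ∈ closedBall (c p) (n * ε),
      ‖fderiv ℝ g y - fderiv ℝ g (x p)‖ < η := fun p hp y hy => by
    rw [← dist_eq_norm]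
    refine hLδ ?_
    rw [mem_closedBall] at hy
    linarith [dist_triangle_right y (x p) (c p), hxb p hp]
  let D : Fin m × (Fin n → ℤ) → Set (EuclideanSpace ℝ (Fin n)) := fun p =>
    (fun y => (T (a p.1)).symm (y - c p)) ⁻¹' closedCenteredCube n ε
  have hDm : ∀ p, MeasurableSet (D p) := fun p =>
    (isClosed_closedCenteredCube.preimage (by fun_prop)).measurableSet
  have hDv : ∀ p, volume (D p) = ENNReal.ofReal ε ^ n := fun p => by
    rw [← volume_closedCenteredCube]
    exact (((T (a p.1)).symm.measurePreserving).comp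
      (measurePreserving_sub_right volume (c p))).measure_preimage
      isClosed_closedCenteredCube.measurableSet.nullMeasurableSet
  have hDr : ∀ p, volume.real (D p) = ε ^ n := fun p => by
    rw [measureReal_def, hDv, ENNReal.toReal_pow, ENNReal.toReal_ofReal hε.le]
  have hDfin : ∀ p, volume (D p) ≠ ⊤ := fun p => by
    rw [hDv]
    exact ENNReal.pow_ne_top ENNReal.ofReal_ne_top
  have hD_ball : ∀ p, D p ⊆ closedBall (c p) (n * ε) := fun p y hy => by
    have := norm_le_of_mem_closedCenteredCube hε.le (Set.mem_preimage.1 hy)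
    rwa [LinearIsometryEquiv.norm_map, ← dist_eq_norm] at this
  set N := K \ ⋃ j, C j
  have hNm : MeasurableSet N :=
    hK.measurableSet.diff (MeasurableSet.iUnion fun j => (hCc j).measurableSet)
  have hNr : volume.real N ≤ η / (B + 1) :=
    ENNReal.toReal_le_of_le_ofReal (by positivity) hCμ
  have hNfin : volume N ≠ ⊤ := (hCμ.trans_lt ENNReal.ofReal_lt_top).ne
  have hpt : ∀ y ∈ K, ‖fderiv ℝ g y‖ ≤
      ∑ p ∈ P, (D p).indicator (fun _ => ‖fderiv ℝ g (x p)‖ + η) y +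
        N.indicator (fun _ => B) y := by
    intro y hy
    have hs : ∀ p ∈ P, 0 ≤ (D p).indicator (fun _ => ‖fderiv ℝ g (x p)‖ + η) y := fun p _ =>
      Set.indicator_nonneg (fun _ _ => by positivity) y
    by_cases hyN : y ∈ N
    · rw [Set.indicator_of_mem hyN]
      linarith [hB y, Finset.sum_nonneg hs]
    · obtain ⟨j, hj⟩ : ∃ j, y ∈ C j := by
        by_contra! h
        exact hyN ⟨hy, by simpa using h⟩
      obtain ⟨p, hp, rfl, hyp⟩ := hPcov j y hj
      have h1 := Finset.single_le_sum hs hp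
      rw [Set.indicator_of_mem (show y ∈ D p from hyp)] at h1
      rw [Set.indicator_of_notMem hyN]
      have h2 := hclose p hp y (hD_ball p hyp)
      linarith [norm_sub_norm_le (fderiv ℝ g y) (fderiv ℝ g (x p))]
  have hiD : ∀ p, Integrable ((D p).indicator fun _ => ‖fderiv ℝ g (x p)‖ + η) := fun p =>
    (integrable_indicator_iff (hDm p)).2 (integrableOn_const (hDfin p))
  have hiN : Integrable (N.indicator fun _ => B) :=
    (integrable_indicator_iff hNm).2 (integrableOn_const hNfin)
  have hiS : Integrable fun y => ∑ p ∈ P, (D p).indicator (fun _ => ‖fderiv ℝ g (x p)‖ + η) y :=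
    integrable_finsetSum _ fun p _ => hiD p
  have hInt : ∫ y in K, ‖fderiv ℝ g y‖ ≤
      ∑ p ∈ P, ε ^ n * (‖fderiv ℝ g (x p)‖ + η) + volume.real N * B := by
    calc ∫ y in K, ‖fderiv ℝ g y‖
        ≤ ∫ y, (∑ p ∈ P, (D p).indicator (fun _ => ‖fderiv ℝ g (x p)‖ + η) y
            + N.indicator (fun _ => B) y) := by
          rw [← integral_indicator hK.measurableSet]
          refine integral_mono ((integrable_indicator_iff hK.measurableSet).2
            (hLc.norm.continuousOn.integrableOn_compact hK)) (hiS.add hiN) fun y => ?_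
          by_cases hy : y ∈ K
          · rw [Set.indicator_of_mem hy]
            exact hpt y hy
          · rw [Set.indicator_of_notMem hy]
            exact add_nonneg (Finset.sum_nonneg fun p _ =>
              Set.indicator_nonneg (fun _ _ => by positivity) y)
              (Set.indicator_nonneg (fun _ _ => hB0) y)
      _ = _ := by
          rw [integral_add hiS hiN, integral_finsetSum _ fun p _ => hiD p]
          simp [integral_indicator_const, hDm, hNm, hDr]
  have hcube : ∀ p ∈ P, ε ^ n * (‖fderiv ℝ g (x p)‖ + η) ≤
      4 / ε * (∫ y, cubeSign i ε y * g (c p + T (a p.1) y)) + 3 * η * ε ^ n := by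
    intro p hp
    have h := le_integral_cubeSign_mul (T := T (a p.1)) (c := c p) i hε.le hg
      (D := ‖fderiv ℝ g (x p)‖ - 2 * η) fun y hy => by
        have h1 := hclose p hp y hy
        have h2 : ‖fderiv ℝ g (x p)‖ < fderiv ℝ g (x p) (T (a p.1) e) + η :=
          (hCU _ (hxC p hp)).2
        have h3 := (fderiv ℝ g y - fderiv ℝ g (x p)).le_opNorm (T (a p.1) e)
        rw [LinearIsometryEquiv.norm_map, he, mul_one, Real.norm_eq_abs, abs_le,
          sub_apply] at h3
        linarith [h3.1]
    have h' := mul_le_mul_of_nonneg_left h (show 0 ≤ 4 / ε by positivity)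
    have h4 : 4 / ε * (ε ^ (n + 1) / 4 * (‖fderiv ℝ g (x p)‖ - 2 * η)) =
        ε ^ n * (‖fderiv ℝ g (x p)‖ - 2 * η) := by
      field_simp
      ring
    rw [h4] at h'
    linarith
  have hvol : ∑ _p ∈ P, ε ^ n ≤ volume.real (cthickening r K) := by
    have hsub : ⋃ p ∈ P, orientedCube (T (a p.1)) (c p) ε ⊆ cthickening r K := by
      refine Set.iUnion₂_subset fun p hp y hy => ?_
      refine mem_cthickening_of_dist_le y (x p) _ _ (hCU _ (hxC p hp)).1 ?_
      have h1 := orientedCube_subset_closedBall hε.le hy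
      rw [mem_closedBall] at h1
      linarith [dist_triangle_right y (x p) (c p), hxb p hp]
    have hfin : ∀ p, volume (orientedCube (T (a p.1)) (c p) ε) ≠ ⊤ := fun p => by
      rw [volume_orientedCube]
      exact ENNReal.pow_ne_top ENNReal.ofReal_ne_top
    have h := measureReal_mono hsub (hK.cthickening.measure_lt_top (μ := volume)).ne
    rw [measureReal_biUnion_finset hPd (fun p _ => isOpen_orientedCube.measurableSet)
      (fun p _ => hfin p)] at h
    refine (Finset.sum_congr rfl fun p _ => ?_).trans_le h
    rw [measureReal_def, volume_orientedCube, ENNReal.toReal_pow, ENNReal.toReal_ofReal hε.le]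
  have hNB : volume.real N * B ≤ η := by
    calc volume.real N * B ≤ η / (B + 1) * (B + 1) := by gcongr; linarith
      _ = η := div_mul_cancel₀ _ (by positivity)
  have hsum := Finset.sum_le_sum hcube
  rw [Finset.sum_add_distrib, ← Finset.mul_sum P _ (4 / ε), ← Finset.mul_sum P _ (3 * η)] at hsum
  have := mul_le_mul_of_nonneg_left hvol (show 0 ≤ 3 * η by positivity)
  linarith

open scoped Convolution

/-- `sum_integral_cubeSign_mul_le_kappa` for mollifications of `f`. -/
theorem sum_integral_cubeSign_mul_convolution_le_kappa {ι : Type*} (i : Fin n) {ε : ℝ}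
    (hε : 0 < ε) (P : Finset ι)
    (T : ι → EuclideanSpace ℝ (Fin n) ≃ₗᵢ[ℝ] EuclideanSpace ℝ (Fin n))
    (c : ι → EuclideanSpace ℝ (Fin n))
    (hd : (P : Set ι).PairwiseDisjoint fun p => orientedCube (T p) (c p) ε)
    {Ω : Set (EuclideanSpace ℝ (Fin n))} {f ρ : EuclideanSpace ℝ (Fin n) → ℝ}
    (hρ : Integrable ρ) (hρ0 : ∀ t, 0 ≤ ρ t) (hρ1 : ∫ t, ρ t = 1)
    (hKf : IntegrableOn f K) (hK : MeasurableSet K) (hKΩ : K ⊆ Ω)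
    (hP : ∀ p ∈ P, ∀ t ∈ Function.support ρ, orientedCube (T p) (c p - t) ε ⊆ K)
    (hg : Integrable (ρ ⋆[ContinuousLinearMap.lsmul ℝ ℝ, volume] K.indicator f))
    (hfin : kappa n ε f Ω ≠ ⊤) :
    ∑ p ∈ P, ∫ y, cubeSign i ε y *
      (ρ ⋆[ContinuousLinearMap.lsmul ℝ ℝ, volume] K.indicator f) (c p + T p y) ≤
      ε * (kappa n ε f Ω).toReal := by
  have hf : Integrable (K.indicator f) := (integrable_indicator_iff hK).2 hKf
  have hm : ∀ p (z : EuclideanSpace ℝ (Fin n)),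
      Measurable fun x => cubeSign i ε ((T p).symm (x - z)) := fun p z =>
    (measurable_cubeSign i).comp (by fun_prop)
  have hInt : ∀ {h : EuclideanSpace ℝ (Fin n) → ℝ}, Integrable h → ∀ p z,
      Integrable fun x => h x * cubeSign i ε ((T p).symm (x - z)) := fun hh p z =>
    hh.mul_bdd (hm p z).aestronglyMeasurable (ae_of_all _ fun _ => abs_cubeSign_le_one i _)
  simp_rw [integral_cubeSign_mul_comp]
  rw [← integral_finsetSum _ fun p _ => hInt hg p (c p)]
  simp_rw [← Finset.mul_sum]
  refine integral_convolution_mul_le hρ hρ0 hρ1 hf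
    (Finset.measurable_fun_sum P fun p _ => hm p (c p)) (C := P.card) (fun x => ?_) fun t ht => ?_
  · refine (Finset.abs_sum_le_sum_abs _ _).trans ?_
    refine (Finset.sum_le_card_nsmul P _ 1 fun p _ => abs_cubeSign_le_one i _).trans_eq ?_
    simp
  · have hxt : ∀ p x, x + t - c p = x - (c p - t) := fun p x => by abel
    have hd' : (P : Set ι).PairwiseDisjoint fun p => orientedCube (T p) (c p - t) ε :=
      fun p hp q hq hpq => Set.disjoint_left.2 fun x hxp hxq =>
        Set.disjoint_left.1 (hd hp hq hpq)
          (show x + t ∈ _ by rwa [mem_orientedCube, hxt, ← mem_orientedCube])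
          (by rwa [mem_orientedCube, hxt, ← mem_orientedCube])
    simp_rw [Finset.mul_sum, hxt]
    rw [integral_finsetSum _ fun p _ => hInt hf p (c p - t)]
    simp_rw [← integral_cubeSign_mul_comp]
    refine (Finset.sum_congr rfl fun p hp => integral_congr_ae (ae_of_all _ fun y => ?_)).trans_le
      (sum_integral_cubeSign_mul_le_kappa i hε P T (fun p => c p - t) hd'
        (fun p hp => (hP p hp t ht).trans hKΩ) (fun p hp => hKf.mono_set (hP p hp t ht)) hfin)
    by_cases hy : y ∈ centeredCube n ε
    · rw [Set.indicator_of_mem (hP p hp t ht ⟨y, hy, rfl⟩)]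
    · simp [cubeSign, hy]

end Estimate

section Variation

open scoped Convolution

variable {n : ℕ} {Ω : Set (EuclideanSpace ℝ (Fin n))} {f : EuclideanSpace ℝ (Fin n) → ℝ}
  {Φ : EuclideanSpace ℝ (Fin n) → EuclideanSpace ℝ (Fin n)}

/-- Mollifying `f` barely changes its pairing with the divergence of `Φ`. -/
theorem integral_mul_vdiv_le_integral_convolution_mul_vdiv (hΦ : ContDiff ℝ 1 Φ)
    (hΦc : HasCompactSupport Φ) {ρ : EuclideanSpace ℝ (Fin n) → ℝ} (hρ : Integrable ρ)
    (hρ0 : ∀ t, 0 ≤ ρ t) (hρ1 : ∫ t, ρ t = 1) (hf : Integrable f) {η : ℝ}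
    (hη : ∀ t ∈ Function.support ρ, ∀ x, |vdiv n Φ (x + t) - vdiv n Φ x| ≤ η) :
    ∫ x, f x * vdiv n Φ x ≤
      (∫ x, (ρ ⋆[ContinuousLinearMap.lsmul ℝ ℝ, volume] f) x * vdiv n Φ x) +
        η * ∫ x, |f x| := by
  have hc := continuous_vdiv hΦ
  obtain ⟨B, hB⟩ := (hasCompactSupport_vdiv hΦc).exists_bound_of_continuous hc
  have hInt : ∀ t, Integrable fun x => f x * vdiv n Φ (x + t) := fun t =>
    hf.mul_bdd (c := B) (by fun_prop) (ae_of_all _ fun x => hB _)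
  have h0 : Integrable fun x => f x * vdiv n Φ x := by simpa using hInt 0
  have key := integral_convolution_mul_le (S := fun x => -vdiv n Φ x) (C := B)
    (M := η * (∫ x, |f x|) - ∫ x, f x * vdiv n Φ x) hρ hρ0 hρ1 hf hc.measurable.neg
    (fun x => by simpa using hB x) fun t ht => by
      rw [← integral_const_mul, ← integral_sub (hf.abs.const_mul η) h0]
      refine integral_mono (by simpa using (hInt t).neg) ((hf.abs.const_mul η).sub h0) fun x => ?_
      have h1 : f x * (vdiv n Φ x - vdiv n Φ (x + t)) ≤ |f x| * η := by
        refine (le_abs_self _).trans ?_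
        rw [abs_mul, abs_sub_comm]
        exact mul_le_mul_of_nonneg_left (hη t ht x) (abs_nonneg _)
      dsimp only
      linarith
  simp only [mul_neg, integral_neg] at key
  linarith

theorem integral_mul_vdiv_le_setIntegral_norm_fderiv (hΦ : ContDiff ℝ 1 Φ)
    (hΦc : HasCompactSupport Φ) (hΦ1 : ∀ x, ‖Φ x‖ ≤ 1) {g : EuclideanSpace ℝ (Fin n) → ℝ}
    (hg : ContDiff ℝ 1 g) :
    ∫ x, g x * vdiv n Φ x ≤ ∫ x in tsupport Φ, ‖fderiv ℝ g x‖ := by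
  have hc := hg.continuous_fderiv one_ne_zero
  have hΦ' := hΦ.continuous
  have hz : ∀ x, x ∉ tsupport Φ → -fderiv ℝ g x (Φ x) = 0 := fun x hx => by
    simp [image_eq_zero_of_notMem_tsupport hx]
  rw [integral_mul_vdiv hΦ hΦc hg, ← integral_neg,
    ← setIntegral_eq_integral_of_forall_compl_eq_zero hz]
  refine setIntegral_mono
    ((by fun_prop : Continuous fun x => -fderiv ℝ g x (Φ x)).continuousOn.integrableOn_compact hΦc)
    (hc.norm.continuousOn.integrableOn_compact hΦc) fun x => ?_
  refine (neg_le_abs _).trans ((fderiv ℝ g x).le_of_opNorm_le_of_le le_rfl (hΦ1 x) |>.trans_eq ?_)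
  rw [mul_one]

/-- Testing `f` against the divergence of a vector field `Φ` with `‖Φ‖ ≤ 1` is controlled by
`4 κ_ε(f, Ω)`, up to an error that vanishes as `ε → 0`. -/
theorem exists_eventually_setIntegral_mul_vdiv_le (i : Fin n) (hΩ : IsOpen Ω)
    (hf : LocallyIntegrableOn f Ω) (hΦ : ContDiff ℝ 1 Φ) (hΦc : HasCompactSupport Φ)
    (hΦΩ : tsupport Φ ⊆ Ω) (hΦ1 : ∀ x, ‖Φ x‖ ≤ 1) :
    ∃ C, 0 ≤ C ∧ ∀ η > 0, ∀ᶠ ε in 𝓝[>] (0 : ℝ), kappa n ε f Ω ≠ ⊤ →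
      ∫ x in Ω, f x * vdiv n Φ x ≤ 4 * (kappa n ε f Ω).toReal + C * η := by
  obtain ⟨r, hr, hrΩ⟩ := hΦc.isCompact.exists_cthickening_subset_open hΩ hΦΩ
  set K := cthickening r (tsupport Φ)
  have hK : IsCompact K := hΦc.isCompact.cthickening
  have hfK : IntegrableOn f K := hf.integrableOn_compact_subset hrΩ hK
  set F := K.indicator f with hFdef
  have hF : Integrable F := (integrable_indicator_iff hK.measurableSet).2 hfK
  refine ⟨(∫ x, |F x|) + (1 + 3 * volume.real (cthickening (r / 2) (tsupport Φ))),
    add_nonneg (integral_nonneg fun _ => abs_nonneg _) (by positivity), fun η hη => ?_⟩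
  obtain ⟨δ, hδ, hδη⟩ := Metric.uniformContinuous_iff.1
    ((hasCompactSupport_vdiv hΦc).uniformContinuous_of_continuous (continuous_vdiv hΦ)) η hη
  have hδ' : 0 < min δ (r / 2) := lt_min hδ (half_pos hr)
  let b : ContDiffBump (0 : EuclideanSpace ℝ (Fin n)) :=
    ⟨min δ (r / 2) / 2, min δ (r / 2), half_pos hδ', half_lt_self hδ'⟩
  set ρ := b.normed volume
  have hρs : ∀ t ∈ Function.support ρ, ‖t‖ < min δ (r / 2) := fun t ht => by
    rwa [b.support_normed_eq, mem_ball_zero_iff] at ht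
  have hρ : Integrable ρ := b.integrable_normed
  have hg : ContDiff ℝ 1 (ρ ⋆[ContinuousLinearMap.lsmul ℝ ℝ, volume] F) :=
    b.hasCompactSupport_normed.contDiff_convolution_left _ b.contDiff_normed hF.locallyIntegrable
  have hgc : HasCompactSupport (ρ ⋆[ContinuousLinearMap.lsmul ℝ ℝ, volume] F) :=
    b.hasCompactSupport_normed.convolution _
      (HasCompactSupport.intro hK fun x hx => Set.indicator_of_notMem hx f)
  have h1 : ∫ x in Ω, f x * vdiv n Φ x = ∫ x, F x * vdiv n Φ x := by
    rw [setIntegral_eq_integral_of_forall_compl_eq_zero fun x hx => by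
      rw [vdiv_eq_zero_of_notMem_tsupport fun h => hx (hΦΩ h), mul_zero]]
    refine integral_congr_ae (ae_of_all _ fun x => ?_)
    by_cases hx : x ∈ tsupport Φ
    · have hxK : x ∈ K := self_subset_cthickening _ hx
      simp [F, hxK]
    · simp [vdiv_eq_zero_of_notMem_tsupport hx]
  have h2 := integral_mul_vdiv_le_integral_convolution_mul_vdiv hΦ hΦc hρ b.nonneg_normed
    b.integral_normed hF (η := η) fun t ht x => by
      rw [← Real.dist_eq]
      exact (hδη (by simpa using (hρs t ht).trans_le (min_le_left _ _))).le
  have h3 := integral_mul_vdiv_le_setIntegral_norm_fderiv hΦ hΦc hΦ1 hg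
  filter_upwards [eventually_setIntegral_norm_fderiv_le i hg hgc hΦc hη (half_pos hr),
    self_mem_nhdsWithin] with ε ⟨m, P, T, c, hd, hP, hle⟩ hε hfin
  have hε : 0 < ε := hε
  have h4 := sum_integral_cubeSign_mul_convolution_le_kappa i hε P T c hd hρ b.nonneg_normed
    b.integral_normed hfK hK.measurableSet hrΩ (fun p hp t ht x hx => by
      have hxt : x + t ∈ orientedCube (T p) (c p) ε := by
        rw [mem_orientedCube] at hx ⊢
        rwa [show x + t - c p = x - (c p - t) by abel]
      have hmem := cthickening_cthickening_subset (half_pos hr).le (half_pos hr).le _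
        (mem_cthickening_of_dist_le x (x + t) (r / 2) _ (hP p hp hxt)
          (by simpa using ((hρs t ht).trans_le (min_le_right _ _)).le))
      rwa [add_halves] at hmem)
    (hg.continuous.integrable_of_hasCompactSupport hgc) hfin
  have h5 := mul_le_mul_of_nonneg_left h4 (show 0 ≤ 4 / ε by positivity)
  rw [← mul_assoc, div_mul_cancel₀ _ hε.ne', ← hFdef] at h5
  rw [h1]
  linarith

end Variation

/-- If `liminf_{ε→0} κ_ε(f, Ω) < ∞`, then `f` has finite
variation in `Ω`, and moreover `(1/4)·Var(f, Ω) ≤ liminf_{ε→0} κ_ε(f, Ω)`. -/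
theorem finite_variation_of_liminf_kappa_lt_top
    (n : ℕ) (hn : 1 ≤ n)
    (Ω : Set (EuclideanSpace ℝ (Fin n))) (hΩ : IsOpen Ω)
    (f : EuclideanSpace ℝ (Fin n) → ℝ) (hf : LocallyIntegrableOn f Ω volume)
    (hfin : liminf (fun ε => kappa n ε f Ω) (𝓝[>] (0:ℝ)) < ⊤) :
    variation n f Ω < ⊤ ∧
    variation n f Ω / 4 ≤ liminf (fun ε => kappa n ε f Ω) (𝓝[>] (0:ℝ)) := by
  set l := liminf (fun ε => kappa n ε f Ω) (𝓝[>] (0 : ℝ))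
  have hvar : variation n f Ω ≤ 4 * l := by
    refine iSup_le fun Φ => iSup_le fun hΦ => iSup_le fun hΦc => iSup_le fun hΦΩ =>
      iSup_le fun hΦ1 => ?_
    refine ENNReal.ofReal_le_of_le_toReal ?_
    rw [ENNReal.toReal_mul, ENNReal.toReal_ofNat]
    refine le_of_forall_pos_le_add fun e he => ?_
    obtain ⟨C, hC, hev⟩ :=
      exists_eventually_setIntegral_mul_vdiv_le ⟨0, hn⟩ hΩ hf hΦ hΦc hΦΩ hΦ1
    have hl : l < ENNReal.ofReal (l.toReal + e / 8) :=
      (ENNReal.lt_ofReal_iff_toReal_lt hfin.ne).2 (by linarith)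
    obtain ⟨ε, hε, hle⟩ := ((frequently_lt_of_liminf_lt (by isBoundedDefault) hl).and_eventually
      (hev (e / (2 * (C + 1))) (by positivity))).exists
    have hκ : (kappa n ε f Ω).toReal < l.toReal + e / 8 :=
      (ENNReal.lt_ofReal_iff_toReal_lt hε.ne_top).1 hε
    have hCe : C * (e / (2 * (C + 1))) ≤ e / 2 := by
      rw [mul_div_assoc', div_le_div_iff₀ (by positivity) two_pos]
      nlinarith
    linarith [hle hε.ne_top]
  exact ⟨hvar.trans_lt (ENNReal.mul_lt_top (by simp) hfin), ENNReal.div_le_of_le_mul' hvar⟩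

end
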